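/- arXiv:2003.06024 — 2 statements merged into one kernel-verified Lean document; each statement's English description precedes it below -/
import Mathlib

section
/- Let n = 2 and let m1, m2 be positive integers with m2 + 1 < m1 < 2·m2 such that (m1 − m2) does not divide m2. Then for almost every pair (Y_1, Y_2) ∈ (ℝ^{m1×m2})² with respect to the measure under which all entries are i.i.d. standard normal, the log-likelihood function ℓ is not bounded above on PD(m1) × PD(m2); in particular the Kronecker maximum likelihood estimator almost surely does not exist for sample size 2. -/
open Matrix MeasureTheory ProbabilityTheory

/-- The matrix normal log-likelihood function. -/
noncomputable def ell {m1 m2 n : ℕ} (Y : Fin n → Matrix (Fin m1) (Fin m2) ℝ)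
    (Ψ1 : Matrix (Fin m1) (Fin m1) ℝ) (Ψ2 : Matrix (Fin m2) (Fin m2) ℝ) : ℝ :=
  (n : ℝ) * m2 * Real.log Ψ1.det + (n : ℝ) * m1 * Real.log Ψ2.det
    - (Ψ1 * ∑ i, Y i * Ψ2 * (Y i)ᵀ).trace

lemma aux_pencil {E F : Type*} [AddCommGroup E] [Module ℝ E] [FiniteDimensional ℝ E]
    [AddCommGroup F] [Module ℝ F] [FiniteDimensional ℝ F] (f g : E →ₗ[ℝ] F) (q : ℕ)
    (h : (q + 2) * Module.finrank ℝ F < (q + 1) * Module.finrank ℝ E) :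
    ∃ (V : Submodule ℝ E) (V' : Submodule ℝ F), Module.finrank ℝ V ≤ q + 1 ∧
      Module.finrank ℝ V' < Module.finrank ℝ V ∧ (∀ x ∈ V, f x ∈ V') ∧ (∀ x ∈ V, g x ∈ V') := by
  let L : (Fin (q + 1) → E) →ₗ[ℝ] (Fin (q + 2) → F) := LinearMap.pi fun j =>
    (if h : j.1 < q + 1 then f ∘ₗ LinearMap.proj ⟨j.1, h⟩ else 0) +
    (if h : 0 < j.1 then g ∘ₗ LinearMap.proj ⟨j.1 - 1, by omega⟩ else 0)
  have hL : LinearMap.ker L ≠ ⊥ := by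
    apply LinearMap.ker_ne_bot_of_finrank_lt
    simpa [Module.finrank_pi_fintype] using h
  obtain ⟨v, hv, hv0⟩ := (Submodule.ne_bot_iff _).mp hL
  have hj : ∀ j, L v j = 0 := fun j => by
    rw [LinearMap.mem_ker.mp hv]; rfl
  have e0 : f (v 0) = 0 := by
    have := hj 0
    simpa [L] using this
  have e1 : ∀ i (hi : i + 1 < q + 1), f (v ⟨i + 1, hi⟩) + g (v ⟨i, by omega⟩) = 0 := by
    intro i hi
    have := hj ⟨i + 1, by omega⟩
    have hp : (0 : Fin (q + 2)) < ⟨i + 1, by omega⟩ := Nat.succ_pos i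
    simpa [L, hi, show i < q by omega, hp] using this
  have e2 : g (v ⟨q, by omega⟩) = 0 := by
    have := hj ⟨q + 1, by omega⟩
    have hp : (0 : Fin (q + 2)) < ⟨q + 1, by omega⟩ := Nat.succ_pos q
    simpa [L, hp] using this
  have hmem : ∀ i, v i ∈ Submodule.span ℝ (Set.range v) :=
    fun i => Submodule.subset_span ⟨i, rfl⟩
  refine ⟨Submodule.span ℝ (Set.range v), (Submodule.span ℝ (Set.range v)).map f, ?_, ?_, ?_, ?_⟩
  · have := finrank_range_le_card (R := ℝ) v
    rw [Fintype.card_fin] at this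
    exact this
  · have hrn := (f.domRestrict (Submodule.span ℝ (Set.range v))).finrank_range_add_finrank_ker
    rw [LinearMap.range_domRestrict] at hrn
    have : 0 < Module.finrank ℝ
        (LinearMap.ker (f.domRestrict (Submodule.span ℝ (Set.range v)))) := by
      rw [Nat.pos_iff_ne_zero]
      intro h0
      rw [Submodule.finrank_eq_zero, LinearMap.ker_eq_bot'] at h0
      apply hv0
      have key : ∀ i, f (v i) = 0 → v i = 0 := fun i hi => by
        have := h0 ⟨v i, hmem i⟩ (by simpa using hi)
        simpa using this
      have : ∀ i (hi : i < q + 1), v ⟨i, hi⟩ = 0 := by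
        intro i
        induction i with
        | zero => intro hi; exact key _ e0
        | succ i ih =>
          intro hi
          apply key
          have := e1 i hi
          rw [ih (by omega)] at this
          simpa using this
      ext i
      exact this i.1 i.2
    omega
  · intro x hx
    exact Submodule.mem_map_of_mem hx
  · have : Submodule.span ℝ (Set.range v) ≤
        ((Submodule.span ℝ (Set.range v)).map f).comap g := by
      rw [Submodule.span_le]
      rintro _ ⟨⟨i, hi⟩, rfl⟩
      simp only [Submodule.comap_coe, Set.mem_preimage, SetLike.mem_coe]
      by_cases hq : i + 1 < q + 1
      · rw [eq_neg_of_add_eq_zero_right (e1 i hq)]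
        exact Submodule.neg_mem _ (Submodule.mem_map_of_mem (hmem _))
      · obtain rfl : i = q := by omega
        rw [e2]; exact Submodule.zero_mem _
    exact fun x hx => this hx

lemma aux_basis {n : ℕ} (V : Submodule ℝ (Fin n → ℝ)) :
    ∃ (b : Module.Basis (Fin n) ℝ (Fin n → ℝ)) (A : Finset (Fin n)),
      A.card = Module.finrank ℝ V ∧ (∀ i ∈ A, b i ∈ V) ∧
      ∀ x ∈ V, ∀ j ∉ A, b.repr x j = 0 := by
  obtain ⟨W, hW⟩ := Submodule.exists_isCompl V
  let b0 := ((Module.finBasis ℝ V).prod (Module.finBasis ℝ W)).map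
    (Submodule.prodEquivOfIsCompl V W hW)
  let e : (Fin (Module.finrank ℝ V) ⊕ Fin (Module.finrank ℝ W)) ≃ Fin n :=
    b0.indexEquiv (Pi.basisFun ℝ (Fin n))
  refine ⟨b0.reindex e, Finset.univ.map (Function.Embedding.inl.trans e.toEmbedding), ?_, ?_, ?_⟩
  · simp
  · intro i hi
    simp only [Finset.mem_map, Finset.mem_univ, true_and] at hi
    obtain ⟨k, rfl⟩ := hi
    simp [b0]
  · intro x hx j hj
    obtain ⟨k, rfl⟩ := e.surjective j
    rcases k with k | k
    · exact absurd (by simp) hj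
    · have h0 : ((Submodule.prodEquivOfIsCompl V W hW).symm x).2 = 0 :=
        (Submodule.prodEquivOfIsCompl_symm_apply_snd_eq_zero _ _ hW).mpr hx
      simp only [b0, Module.Basis.repr_reindex_apply, Equiv.symm_apply_apply,
        Module.Basis.map_repr, LinearEquiv.trans_apply, Module.Basis.prod_repr_inr, h0]
      simp

lemma aux_unbdd {m1 m2 : ℕ} (Y : Fin 2 → Matrix (Fin m1) (Fin m2) ℝ)
    (P : Matrix (Fin m1) (Fin m1) ℝ) (R : Matrix (Fin m2) (Fin m2) ℝ)
    (hP : P.det ≠ 0) (hR : R.det ≠ 0) (A : Finset (Fin m1)) (B : Finset (Fin m2))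
    (hM : ∀ k, ∀ i ∈ A, ∀ j ∉ B, (P * Y k * Rᵀ) i j = 0)
    (hAB : m1 * B.card < m2 * A.card) :
    ¬ ∃ C : ℝ, ∀ (Ψ1 : Matrix (Fin m1) (Fin m1) ℝ) (Ψ2 : Matrix (Fin m2) (Fin m2) ℝ),
        Ψ1.PosDef → Ψ2.PosDef → ell Y Ψ1 Ψ2 ≤ C := by
  rintro ⟨C, hC⟩
  have pd : ∀ {n : ℕ} (Q : Matrix (Fin n) (Fin n) ℝ) (d : Fin n → ℝ), Q.det ≠ 0 →
      (∀ i, 0 < d i) → (Qᵀ * diagonal d * Q).PosDef := by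
    intro n Q d hQ hd
    have h1 : (diagonal d).PosDef := Matrix.PosDef.diagonal hd
    have := h1.conjTranspose_mul_mul_same (B := Q)
      (Matrix.mulVec_injective_of_isUnit ((Matrix.isUnit_iff_isUnit_det Q).mpr hQ.isUnit))
    simpa using this
  have ld : ∀ {n : ℕ} (Q : Matrix (Fin n) (Fin n) ℝ) (A : Finset (Fin n)) (s : ℝ), Q.det ≠ 0 →
      Real.log (Qᵀ * diagonal (fun i => if i ∈ A then Real.exp s else 1) * Q).det
        = 2 * Real.log Q.det + A.card * s := by
    intro n Q A s hQ
    have : (∏ i, if i ∈ A then Real.exp s else 1) = Real.exp (A.card * s) := by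
      rw [Finset.prod_ite_mem, Finset.univ_inter, Finset.prod_const, ← Real.exp_nat_mul]
    rw [det_mul, det_mul, det_transpose, det_diagonal, this,
      Real.log_mul (mul_ne_zero hQ (Real.exp_ne_zero _)) hQ,
      Real.log_mul hQ (Real.exp_ne_zero _), Real.log_exp]
    ring
  have tr : ∀ (d1 : Fin m1 → ℝ) (d2 : Fin m2 → ℝ),
      ((Pᵀ * diagonal d1 * P) * ∑ k, Y k * (Rᵀ * diagonal d2 * R) * (Y k)ᵀ).trace
        = ∑ k, ∑ i, ∑ j, d1 i * d2 j * ((P * Y k * Rᵀ) i j) ^ 2 := by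
    intro d1 d2
    rw [Finset.mul_sum, trace_sum]
    refine Finset.sum_congr rfl fun k _ => ?_
    have : (Pᵀ * diagonal d1 * P) * (Y k * (Rᵀ * diagonal d2 * R) * (Y k)ᵀ)
        = Pᵀ * (diagonal d1 * (P * Y k * Rᵀ) * diagonal d2 * (R * (Y k)ᵀ)) := by
      simp only [Matrix.mul_assoc]
    rw [this, trace_mul_comm]
    have : diagonal d1 * (P * Y k * Rᵀ) * diagonal d2 * (R * (Y k)ᵀ) * Pᵀ
        = diagonal d1 * (P * Y k * Rᵀ) * diagonal d2 * (P * Y k * Rᵀ)ᵀ := by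
      simp only [Matrix.mul_assoc, transpose_mul, transpose_transpose]
    rw [this, trace]
    refine Finset.sum_congr rfl fun i _ => ?_
    rw [diag_apply, mul_apply]
    refine Finset.sum_congr rfl fun j _ => ?_
    rw [mul_diagonal, diagonal_mul, transpose_apply]
    ring
  set K : ℝ := ∑ k, ∑ i, ∑ j, ((P * Y k * Rᵀ) i j) ^ 2 with hK
  set c0 : ℝ := 2 * m2 * (2 * Real.log P.det) + 2 * m1 * (2 * Real.log R.det) with hc0
  have main : ∀ s : ℝ, 0 ≤ s → c0 + 2 * ((m2 * A.card : ℝ) - m1 * B.card) * s - K ≤ C := by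
    intro s hs
    have h := hC (Pᵀ * diagonal (fun i => if i ∈ A then Real.exp s else 1) * P)
      (Rᵀ * diagonal (fun i => if i ∈ B then Real.exp (-s) else 1) * R)
      (pd P _ hP (fun i => by split_ifs <;> positivity))
      (pd R _ hR (fun i => by split_ifs <;> positivity))
    unfold ell at h
    rw [ld P A s hP, ld R B (-s) hR, tr] at h
    have hle : ∑ k, ∑ i, ∑ j, (if i ∈ A then Real.exp s else 1) *
        (if j ∈ B then Real.exp (-s) else 1) * ((P * Y k * Rᵀ) i j) ^ 2 ≤ K := by
      refine Finset.sum_le_sum fun k _ => Finset.sum_le_sum fun i _ =>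
        Finset.sum_le_sum fun j _ => ?_
      by_cases hi : i ∈ A
      · by_cases hj : j ∈ B
        · simp [hi, hj, ← Real.exp_add]
        · simp [hM k i hi j hj]
      · by_cases hj : j ∈ B
        · simp only [hi, hj, if_true, if_false, one_mul]
          exact mul_le_of_le_one_left (sq_nonneg _) (Real.exp_le_one_iff.mpr (by linarith))
        · simp [hi, hj]
    push_cast at h
    rw [hc0]
    nlinarith
  have hpos : (0 : ℝ) < (m2 * A.card : ℝ) - m1 * B.card := by
    have : ((m1 * B.card : ℕ) : ℝ) < ((m2 * A.card : ℕ) : ℝ) := by exact_mod_cast hAB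
    push_cast at this
    linarith
  set D : ℝ := (m2 * A.card : ℝ) - m1 * B.card with hD
  have h := main ((|C + K - c0| + 1) / D) (by positivity)
  have e : 2 * D * ((|C + K - c0| + 1) / D) = 2 * (|C + K - c0| + 1) := by
    field_simp
  rw [e] at h
  have := le_abs_self (C + K - c0)
  have := abs_nonneg (C + K - c0)
  linarith

/-- For sample size `n = 2` and `m2 + 1 < m1 < 2·m2` with `(m1 − m2) ∤ m2`, for almost
every pair `(Y_1, Y_2)` of `m1 × m2` matrices with i.i.d. standard normal entries the
log-likelihood `ℓ` is not bounded above on `PD(m1) × PD(m2)`; in particular the Kronecker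
MLE almost surely does not exist. -/
theorem stmt18 {m1 m2 : ℕ} (h1 : m2 + 1 < m1) (h2 : m1 < 2 * m2)
    (hdvd : ¬ (m1 - m2) ∣ m2) :
    ∀ᵐ y : Fin 2 × Fin m1 × Fin m2 → ℝ
        ∂(Measure.pi fun _ => gaussianReal 0 1),
      ¬ ∃ C : ℝ, ∀ (Ψ1 : Matrix (Fin m1) (Fin m1) ℝ) (Ψ2 : Matrix (Fin m2) (Fin m2) ℝ),
        Ψ1.PosDef → Ψ2.PosDef →
        ell (fun i : Fin 2 => Matrix.of fun r c => y (i, r, c)) Ψ1 Ψ2 ≤ C := by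
  refine Filter.Eventually.of_forall fun y => ?_
  set Y : Fin 2 → Matrix (Fin m1) (Fin m2) ℝ :=
    fun i : Fin 2 => Matrix.of fun r c => y (i, r, c) with hY
  set d := m1 - m2 with hd
  have hd0 : 0 < d := by omega
  set q := m2 / d with hq
  have hm1 : m1 = m2 + d := by omega
  have hlt : q * d < m2 := by
    rcases lt_or_eq_of_le (Nat.div_mul_le_self m2 d) with h | h
    · exact h
    · exact absurd ⟨q, by rw [mul_comm]; exact h.symm⟩ hdvd
  have hlt2 : m2 < (q + 1) * d := by
    have := Nat.lt_div_mul_add (a := m2) hd0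
    rw [add_mul, one_mul]; exact this
  obtain ⟨V, V', hVq, hV', hf, hg⟩ := aux_pencil (Matrix.mulVecLin (Y 0)ᵀ)
    (Matrix.mulVecLin (Y 1)ᵀ) q (by simp; rw [hm1]; nlinarith)
  obtain ⟨b, A, hA, hbA, -⟩ := aux_basis V
  obtain ⟨c, B, hB, -, hcB⟩ := aux_basis V'
  have hY' : ∀ k, ∀ x ∈ V, (Y k)ᵀ *ᵥ x ∈ V' := by
    intro k
    fin_cases k
    · exact hf
    · exact hg
  refine aux_unbdd Y (Matrix.of b) (c.toMatrix (Pi.basisFun ℝ (Fin m2))) ?_ ?_ A B ?_ ?_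
  · have h := (Pi.basisFun ℝ (Fin m1)).toMatrix_mul_toMatrix_flip b
    have e : (Pi.basisFun ℝ (Fin m1)).toMatrix b = (Matrix.of b)ᵀ := by
      ext i j; simp [Module.Basis.toMatrix_apply]
    rw [e] at h
    have h2 := congrArg Matrix.det h
    rw [det_mul, det_transpose, det_one] at h2
    exact left_ne_zero_of_mul_eq_one h2
  · have h2 := congrArg Matrix.det (c.toMatrix_mul_toMatrix_flip (Pi.basisFun ℝ (Fin m2)))
    rw [det_mul, det_one] at h2
    exact left_ne_zero_of_mul_eq_one h2
  · intro k i hi j hj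
    have h := hcB _ (hY' k _ (hbA i hi)) j hj
    rw [← Module.Basis.toMatrix_mulVec_repr (Pi.basisFun ℝ (Fin m2)) c] at h
    rw [← h, mul_apply, mulVec, dotProduct]
    refine Finset.sum_congr rfl fun l _ => ?_
    rw [transpose_apply, mul_comm]
    congr 1
    simp [mul_apply, mulVec, dotProduct, mul_comm]
  · rw [hA, hB]
    generalize Module.finrank ℝ V = p at hVq hV' ⊢
    generalize Module.finrank ℝ V' = p' at hV' ⊢
    suffices (m2 + d) * p' < m2 * p by rwa [← hm1] at this
    obtain ⟨r, rfl⟩ : ∃ r, p = r + 1 := ⟨p - 1, by omega⟩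
    have h3 : p' ≤ r := by omega
    have h4 : r ≤ q := by omega
    have h5 : d * r ≤ d * q := Nat.mul_le_mul_left _ h4
    have h6 : (m2 + d) * p' ≤ (m2 + d) * r := Nat.mul_le_mul_left _ h3
    nlinarith
end

section
/- Let n = 2, m ≥ 2, m1 = m + 1, and m2 = m. Then for almost every pair (Y_1, Y_2) ∈ (ℝ^{(m+1)×m})² with respect to the measure under which all entries are i.i.d. standard normal, the log-likelihood function ℓ attains its maximum on PD(m+1) × PD(m), and any two maximizers (Ψ1, Ψ2) and (Φ1, Φ2) satisfy Ψ2 ⊗ Ψ1 = Φ2 ⊗ Φ1 (equality of Kronecker products); that is, the Kronecker maximum likelihood estimator exists uniquely almost surely for sample size 2 when m1 = m2 + 1. -/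
open Matrix MeasureTheory ProbabilityTheory Kronecker

lemma poly_ae_fin (μ : Measure ℝ) [IsProbabilityMeasure μ] [NullSingletonClass μ] :
    ∀ (n : ℕ) (p : MvPolynomial (Fin n) ℝ), p ≠ 0 →
      ∀ᵐ x ∂(Measure.pi fun _ : Fin n => μ), MvPolynomial.eval x p ≠ 0 := by
  intro n
  induction n with
  | zero =>
    intro p hp
    refine Filter.Eventually.of_forall fun x hx => hp ?_
    refine MvPolynomial.funext fun y => ?_
    rw [Subsingleton.elim y x, hx, map_zero]
  | succ n ih =>
    intro p hp
    have hq : MvPolynomial.finSuccEquiv ℝ n p ≠ 0 := by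
      simpa using hp
    have hlc : (MvPolynomial.finSuccEquiv ℝ n p).leadingCoeff ≠ 0 := by
      simpa using hq
    have h1 := ih _ hlc
    have key : ∀ᵐ z ∂((Measure.pi fun _ : Fin n => μ).prod μ),
        MvPolynomial.eval (Fin.cons z.2 z.1 : Fin (n+1) → ℝ) p ≠ 0 := by
      have hmeas : MeasurableSet {z : (Fin n → ℝ) × ℝ |
          MvPolynomial.eval (Fin.cons z.2 z.1 : Fin (n+1) → ℝ) p = 0} := by
        apply IsClosed.measurableSet
        apply isClosed_eq _ continuous_const
        apply (MvPolynomial.continuous_eval p).comp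
        refine continuous_pi fun i => ?_
        refine Fin.cases ?_ (fun j => ?_) i
        · simpa using continuous_snd
        · simp only [Fin.cons_succ]
          fun_prop
      rw [ae_iff]
      simp only [not_not]
      rw [Measure.measure_prod_null hmeas]
      filter_upwards [h1] with s hs
      have hne : Polynomial.map (MvPolynomial.eval s) (MvPolynomial.finSuccEquiv ℝ n p) ≠ 0 := by
        intro h
        apply hs
        have := congrArg (fun q => q.coeff (MvPolynomial.finSuccEquiv ℝ n p).natDegree) h
        simpa [Polynomial.coeff_map] using this
      refine Set.Finite.measure_zero (Set.Finite.subset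
        (Polynomial.map (MvPolynomial.eval s) (MvPolynomial.finSuccEquiv ℝ n p)).roots.toFinset.finite_toSet ?_) μ
      intro t ht
      simp only [Set.mem_preimage, Set.mem_ofPred_eq] at ht
      rw [MvPolynomial.eval_eq_eval_mv_eval'] at ht
      simp [hne, ht]
    have mp := (measurePreserving_piFinSuccAbove (fun _ : Fin (n+1) => μ) 0)
    have mp2 := (Measure.measurePreserving_swap (μ := μ) (ν := Measure.pi fun _ : Fin n => μ)).comp mp
    have := mp2.quasiMeasurePreserving.ae key
    filter_upwards [this] with x hx
    convert hx using 2
    congr 1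
    funext i
    refine Fin.cases ?_ (fun j => ?_) i <;> simp [MeasurableEquiv.piFinSuccAbove, Fin.tail]

lemma poly_ae {σ : Type} [Fintype σ] (μ : Measure ℝ) [IsProbabilityMeasure μ] [NullSingletonClass μ]
    (p : MvPolynomial σ ℝ) (hp : p ≠ 0) :
    ∀ᵐ x ∂(Measure.pi fun _ : σ => μ), MvPolynomial.eval x p ≠ 0 := by
  let e := Fintype.equivFin σ
  have h := poly_ae_fin μ _ (MvPolynomial.rename e p) (by
    simpa using (MvPolynomial.rename_injective e e.injective).ne hp)
  have mp := measurePreserving_piCongrLeft (fun _ : Fin (Fintype.card σ) => μ) e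
  have := mp.quasiMeasurePreserving.ae h
  filter_upwards [this] with x hx
  rw [MvPolynomial.eval_rename] at hx
  convert hx using 2
  congr 1
  funext i
  simp [MeasurableEquiv.coe_piCongrLeft]

/-- polynomial functions -/
def IsPolyFn {σ : Type} (f : (σ → ℝ) → ℝ) : Prop := ∃ p : MvPolynomial σ ℝ, ∀ y, f y = MvPolynomial.eval y p

namespace IsPolyFn
variable {σ : Type}
lemma const (c : ℝ) : IsPolyFn (fun _ : σ → ℝ => c) := ⟨MvPolynomial.C c, by simp⟩
lemma coord (i : σ) : IsPolyFn (fun y : σ → ℝ => y i) := ⟨MvPolynomial.X i, by simp⟩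
lemma add {f g : (σ → ℝ) → ℝ} (hf : IsPolyFn f) (hg : IsPolyFn g) : IsPolyFn (fun y => f y + g y) := by
  obtain ⟨p, hp⟩ := hf
  obtain ⟨q, hq⟩ := hg
  exact ⟨p + q, by simp [hp, hq]⟩
lemma mul {f g : (σ → ℝ) → ℝ} (hf : IsPolyFn f) (hg : IsPolyFn g) : IsPolyFn (fun y => f y * g y) := by
  obtain ⟨p, hp⟩ := hf
  obtain ⟨q, hq⟩ := hg
  exact ⟨p * q, by simp [hp, hq]⟩
lemma sub {f g : (σ → ℝ) → ℝ} (hf : IsPolyFn f) (hg : IsPolyFn g) : IsPolyFn (fun y => f y - g y) := by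
  obtain ⟨p, hp⟩ := hf
  obtain ⟨q, hq⟩ := hg
  exact ⟨p - q, by simp [hp, hq]⟩
lemma sum {ι : Type} (s : Finset ι) {f : ι → (σ → ℝ) → ℝ} (hf : ∀ i, IsPolyFn (f i)) :
    IsPolyFn (fun y => ∑ i ∈ s, f i y) := by
  choose p hp using hf
  exact ⟨∑ i ∈ s, p i, by simp [hp]⟩
lemma prod {ι : Type} (s : Finset ι) {f : ι → (σ → ℝ) → ℝ} (hf : ∀ i, IsPolyFn (f i)) :
    IsPolyFn (fun y => ∏ i ∈ s, f i y) := by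
  choose p hp using hf
  exact ⟨∏ i ∈ s, p i, by simp [hp]⟩
lemma det {ι : Type} [Fintype ι] [DecidableEq ι] {M : (σ → ℝ) → Matrix ι ι ℝ}
    (hM : ∀ i j, IsPolyFn (fun y => M y i j)) : IsPolyFn (fun y => (M y).det) := by
  simp only [Matrix.det_apply']
  exact sum _ fun s => mul (const _) (prod _ fun i => hM _ _)
lemma cramer {ι : Type} [Fintype ι] [DecidableEq ι] {M : (σ → ℝ) → Matrix ι ι ℝ}
    (hM : ∀ i j, IsPolyFn (fun y => M y i j)) (b : ι → ℝ) (i : ι) :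
    IsPolyFn (fun y => Matrix.cramer (M y) b i) := by
  simp only [Matrix.cramer_apply]
  refine det fun k l => ?_
  by_cases h : l = i
  · subst h
    simpa using const _
  · simpa [Matrix.updateCol_ne h] using hM k l
lemma ae_ne [Fintype σ] {f : (σ → ℝ) → ℝ} (hf : IsPolyFn f) (y₀ : σ → ℝ) (h0 : f y₀ ≠ 0) :
    ∀ᵐ y ∂(Measure.pi fun _ : σ => gaussianReal 0 1), f y ≠ 0 := by
  obtain ⟨p, hp⟩ := hf
  have : NullSingletonClass (gaussianReal 0 1) := nullSingletonClass_gaussianReal (by simp)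
  filter_upwards [poly_ae (gaussianReal 0 1) p (by
    rintro rfl
    simp [hp] at h0)] with y hy
  rwa [hp]
end IsPolyFn

lemma exists_diag {n : ℕ} {A : Matrix (Fin n) (Fin n) ℝ} (hA : A.PosDef) :
    ∃ (U : Matrix (Fin n) (Fin n) ℝ) (d : Fin n → ℝ), (∀ i, 0 < d i) ∧ Uᵀ * U = 1 ∧ U * Uᵀ = 1 ∧
      A = U * diagonal d * Uᵀ := by
  refine ⟨hA.1.eigenvectorUnitary, hA.1.eigenvalues, hA.eigenvalues_pos, ?_, ?_, ?_⟩
  · have := Unitary.coe_star_mul_self hA.1.eigenvectorUnitary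
    rwa [star_eq_conjTranspose, conjTranspose_eq_transpose_of_trivial] at this
  · rw [mul_eq_one_comm]
    have := Unitary.coe_star_mul_self hA.1.eigenvectorUnitary
    rwa [star_eq_conjTranspose, conjTranspose_eq_transpose_of_trivial] at this
  · have := hA.1.spectral_theorem
    rw [Unitary.conjStarAlgAut_apply, star_eq_conjTranspose,
      conjTranspose_eq_transpose_of_trivial] at this
    exact this

lemma sub_exp_le {x : ℝ} (hx : 0 < x) : Real.log x - x ≤ -1 := by
  linarith [Real.log_le_sub_one_of_pos hx]

lemma eq_one_of_log {x : ℝ} (hx : 0 < x) (h : Real.log x - x = -1) : x = 1 := by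
  by_contra hne
  linarith [Real.log_lt_sub_one_of_pos hx hne]

lemma trace_diag {m1 m2 n : ℕ} (X : Fin n → Matrix (Fin m1) (Fin m2) ℝ) (d : Fin m1 → ℝ)
    (g : Fin m2 → ℝ) :
    (diagonal d * ∑ i, X i * diagonal g * (X i)ᵀ).trace =
      ∑ k, ∑ j, (∑ i, X i k j ^ 2) * (d k * g j) := by
  simp only [Matrix.trace, diag_apply, diagonal_mul, Matrix.sum_apply, Matrix.mul_apply (M := _ * _),
    Matrix.mul_diagonal, transpose_apply]
  refine Finset.sum_congr rfl fun k _ => ?_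
  rw [Finset.sum_comm, Finset.mul_sum]
  refine Finset.sum_congr rfl fun j _ => ?_
  rw [Finset.mul_sum, Finset.sum_mul]
  exact Finset.sum_congr rfl fun i _ => by ring

lemma diag_case {m1 m2 n : ℕ} (X : Fin n → Matrix (Fin m1) (Fin m2) ℝ)
    (h1 : ∑ i, X i * (X i)ᵀ = ((n : ℝ) * m2) • (1 : Matrix (Fin m1) (Fin m1) ℝ))
    (h2 : ∑ i, (X i)ᵀ * X i = ((n : ℝ) * m1) • (1 : Matrix (Fin m2) (Fin m2) ℝ))
    (d : Fin m1 → ℝ) (g : Fin m2 → ℝ) (hd : ∀ i, 0 < d i) (hg : ∀ j, 0 < g j) :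
    ell X (diagonal d) (diagonal g) ≤ - ((n : ℝ) * m2 * m1) ∧
    (ell X (diagonal d) (diagonal g) = - ((n : ℝ) * m2 * m1) →
      ∀ i, diagonal d * X i * diagonal g = X i) := by
  have r1 : ∀ k, ∑ j, ∑ i, X i k j ^ 2 = (n : ℝ) * m2 := by
    intro k
    have := congrFun (congrFun h1 k) k
    simp only [Matrix.sum_apply, Matrix.mul_apply, transpose_apply, Matrix.smul_apply, one_apply_eq,
      smul_eq_mul, mul_one] at this
    rw [← this, Finset.sum_comm]
    simp only [pow_two]
  have r2 : ∀ j, ∑ k, ∑ i, X i k j ^ 2 = (n : ℝ) * m1 := by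
    intro j
    have := congrFun (congrFun h2 j) j
    simp only [Matrix.sum_apply, Matrix.mul_apply, transpose_apply, Matrix.smul_apply, one_apply_eq,
      smul_eq_mul, mul_one] at this
    rw [← this, Finset.sum_comm]
    simp only [pow_two]
  set w : Fin m1 → Fin m2 → ℝ := fun k j => ∑ i, X i k j ^ 2 with hw
  have w0 : ∀ k j, 0 ≤ w k j := fun k j => Finset.sum_nonneg fun i _ => sq_nonneg _
  have hlogd : Real.log (diagonal d).det = ∑ k, Real.log (d k) := by
    rw [det_diagonal, Real.log_prod fun i _ => (hd i).ne']
  have hlogg : Real.log (diagonal g).det = ∑ k, Real.log (g k) := by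
    rw [det_diagonal, Real.log_prod fun i _ => (hg i).ne']
  have hell : ell X (diagonal d) (diagonal g) =
      ∑ k, ∑ j, w k j * (Real.log (d k * g j) - d k * g j) := by
    have e1 : ∑ k, ∑ j, w k j * (Real.log (d k * g j) - d k * g j) =
      ∑ k, (∑ j, w k j) * Real.log (d k) + ∑ j, (∑ k, w k j) * Real.log (g j)
        - ∑ k, ∑ j, w k j * (d k * g j) := by
      simp only [Finset.sum_mul]
      rw [Finset.sum_comm (f := fun j k => w k j * Real.log (g j))]
      simp only [← Finset.sum_add_distrib, ← Finset.sum_sub_distrib]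
      refine Finset.sum_congr rfl fun k _ => Finset.sum_congr rfl fun j _ => ?_
      rw [Real.log_mul (hd k).ne' (hg j).ne']
      ring
    rw [e1, ell, trace_diag, hlogd, hlogg]
    simp only [hw, r1, r2, Finset.mul_sum]
  have hconst : - ((n : ℝ) * m2 * m1) = ∑ k, ∑ j, w k j * (-1) := by
    simp only [← Finset.sum_mul, hw, r1]
    simp
    ring
  have hterm : ∀ k j, w k j * (Real.log (d k * g j) - d k * g j) ≤ w k j * (-1) := fun k j =>
    mul_le_mul_of_nonneg_left (sub_exp_le (mul_pos (hd k) (hg j))) (w0 k j)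
  rw [hell, hconst]
  refine ⟨Finset.sum_le_sum fun k _ => Finset.sum_le_sum fun j _ => hterm k j, ?_⟩
  intro heq i
  have hk := (Finset.sum_eq_sum_iff_of_le fun k _ => Finset.sum_le_sum fun j _ => hterm k j).1 heq
  ext k j
  have hkj := (Finset.sum_eq_sum_iff_of_le fun j _ => hterm k j).1 (hk k (Finset.mem_univ _)) j
    (Finset.mem_univ _)
  simp only [mul_diagonal, diagonal_mul]
  by_cases hx : X i k j = 0
  · simp [hx]
  · have wpos : w k j ≠ 0 := by
      have : 0 < w k j := Finset.sum_pos' (fun i _ => sq_nonneg _) ⟨i, Finset.mem_univ _, by positivity⟩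
      exact this.ne'
    have := eq_one_of_log (mul_pos (hd k) (hg j)) (mul_left_cancel₀ wpos hkj)
    linear_combination (X i k j) * this

lemma balanced {m1 m2 n : ℕ} (Y : Fin n → Matrix (Fin m1) (Fin m2) ℝ)
    (h1 : ∑ i, Y i * (Y i)ᵀ = ((n : ℝ) * m2) • (1 : Matrix (Fin m1) (Fin m1) ℝ))
    (h2 : ∑ i, (Y i)ᵀ * Y i = ((n : ℝ) * m1) • (1 : Matrix (Fin m2) (Fin m2) ℝ))
    {Φ1 : Matrix (Fin m1) (Fin m1) ℝ} {Φ2 : Matrix (Fin m2) (Fin m2) ℝ}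
    (hΦ1 : Φ1.PosDef) (hΦ2 : Φ2.PosDef) :
    ell Y Φ1 Φ2 ≤ ell Y 1 1 ∧ (ell Y Φ1 Φ2 = ell Y 1 1 → ∀ i, Φ1 * Y i * Φ2 = Y i) := by
  obtain ⟨U, d, hd, hU, hU', rfl⟩ := exists_diag hΦ1
  obtain ⟨V, g, hg, hV, hV', rfl⟩ := exists_diag hΦ2
  have hone : ell Y 1 1 = - ((n : ℝ) * m2 * m1) := by
    simp [ell, h1]
  have e1 : ∀ i, (Uᵀ * Y i * V) * (Uᵀ * Y i * V)ᵀ = Uᵀ * (Y i * (Y i)ᵀ) * U := fun i => by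
    simp only [transpose_mul, transpose_transpose]
    calc _ = Uᵀ * Y i * (V * Vᵀ) * (Y i)ᵀ * U := by simp only [Matrix.mul_assoc]
      _ = _ := by rw [hV']; simp only [Matrix.mul_assoc, Matrix.mul_one]
  have e2 : ∀ i, (Uᵀ * Y i * V)ᵀ * (Uᵀ * Y i * V) = Vᵀ * ((Y i)ᵀ * (Y i)) * V := fun i => by
    simp only [transpose_mul, transpose_transpose]
    calc _ = Vᵀ * (Y i)ᵀ * (U * Uᵀ) * Y i * V := by simp only [Matrix.mul_assoc]
      _ = _ := by rw [hU']; simp only [Matrix.mul_assoc, Matrix.one_mul]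
  have key := diag_case (fun i => Uᵀ * Y i * V) (by
      simp only [e1]
      rw [← Finset.sum_mul, ← Finset.mul_sum, h1]
      simp [hU]) (by
      simp only [e2]
      rw [← Finset.sum_mul, ← Finset.mul_sum, h2]
      simp [hV]) d g hd hg
  have detU : U.det * Uᵀ.det = 1 := by rw [← det_mul, hU', det_one]
  have detV : V.det * Vᵀ.det = 1 := by rw [← det_mul, hV', det_one]
  have hell : ell Y (U * diagonal d * Uᵀ) (V * diagonal g * Vᵀ) =
      ell (fun i => Uᵀ * Y i * V) (diagonal d) (diagonal g) := by
    have d1 : (U * diagonal d * Uᵀ).det = (diagonal d).det := by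
      rw [det_mul, det_mul]
      linear_combination (diagonal d).det * detU
    have d2 : (V * diagonal g * Vᵀ).det = (diagonal g).det := by
      rw [det_mul, det_mul]
      linear_combination (diagonal g).det * detV
    unfold ell
    rw [d1, d2]
    congr 1
    have : ∑ i, (Uᵀ * Y i * V) * diagonal g * (Uᵀ * Y i * V)ᵀ =
        Uᵀ * (∑ i, Y i * (V * diagonal g * Vᵀ) * (Y i)ᵀ) * U := by
      simp only [Finset.sum_mul, Finset.mul_sum, transpose_mul, transpose_transpose,
        Matrix.mul_assoc]
    rw [this, Matrix.mul_assoc U, Matrix.mul_assoc U, trace_mul_comm]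
    simp only [Matrix.mul_assoc]
  rw [hell, hone]
  refine ⟨key.1, fun h i => ?_⟩
  have := key.2 h i
  calc U * diagonal d * Uᵀ * Y i * (V * diagonal g * Vᵀ) =
        U * (diagonal d * (Uᵀ * Y i * V) * diagonal g) * Vᵀ := by simp only [Matrix.mul_assoc]
    _ = (U * Uᵀ) * Y i * (V * Vᵀ) := by rw [this]; simp only [Matrix.mul_assoc]
    _ = Y i := by rw [hU', hV']; simp

/-- Conclusion of the theorem for a fixed sample, with a transferred sample `E`. -/
lemma transfer {m1 m2 n : ℕ} (Y E : Fin n → Matrix (Fin m1) (Fin m2) ℝ)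
    (h1 : ∑ i, E i * (E i)ᵀ = ((n : ℝ) * m2) • (1 : Matrix (Fin m1) (Fin m1) ℝ))
    (h2 : ∑ i, (E i)ᵀ * E i = ((n : ℝ) * m1) • (1 : Matrix (Fin m2) (Fin m2) ℝ))
    (hrig : ∀ (Φ1 : Matrix (Fin m1) (Fin m1) ℝ) (Φ2 : Matrix (Fin m2) (Fin m2) ℝ),
      Φ1.PosDef → Φ2.PosDef → (∀ i, Φ1 * E i * Φ2 = E i) → Φ2 ⊗ₖ Φ1 = 1)
    (F : Matrix (Fin m1) (Fin m1) ℝ) (Z : Matrix (Fin m2) (Fin m2) ℝ)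
    (hF : F.det ≠ 0) (hZ : Z.det ≠ 0) (hFZ : ∀ i, F * Y i = E i * Z) :
    (∃ (Ψ1 : Matrix (Fin m1) (Fin m1) ℝ) (Ψ2 : Matrix (Fin m2) (Fin m2) ℝ),
        Ψ1.PosDef ∧ Ψ2.PosDef ∧
        ∀ (Φ1 : Matrix (Fin m1) (Fin m1) ℝ) (Φ2 : Matrix (Fin m2) (Fin m2) ℝ),
          Φ1.PosDef → Φ2.PosDef → ell Y Φ1 Φ2 ≤ ell Y Ψ1 Ψ2) ∧
      (∀ (Ψ1 Φ1 : Matrix (Fin m1) (Fin m1) ℝ)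
          (Ψ2 Φ2 : Matrix (Fin m2) (Fin m2) ℝ),
        Ψ1.PosDef → Ψ2.PosDef → Φ1.PosDef → Φ2.PosDef →
        (∀ (Θ1 : Matrix (Fin m1) (Fin m1) ℝ) (Θ2 : Matrix (Fin m2) (Fin m2) ℝ),
          Θ1.PosDef → Θ2.PosDef → ell Y Θ1 Θ2 ≤ ell Y Ψ1 Ψ2) →
        (∀ (Θ1 : Matrix (Fin m1) (Fin m1) ℝ) (Θ2 : Matrix (Fin m2) (Fin m2) ℝ),
          Θ1.PosDef → Θ2.PosDef → ell Y Θ1 Θ2 ≤ ell Y Φ1 Φ2) →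
        Ψ2 ⊗ₖ Ψ1 = Φ2 ⊗ₖ Φ1) := by
  set G := F⁻¹ with hGdef
  have hFu : IsUnit F.det := isUnit_iff_ne_zero.2 hF
  have hZu : IsUnit Z.det := isUnit_iff_ne_zero.2 hZ
  have hGF : G * F = 1 := nonsing_inv_mul F hFu
  have hFG : F * G = 1 := mul_nonsing_inv F hFu
  have hGdet : G.det ≠ 0 := by
    intro h
    have := congrArg Matrix.det hGF
    simp [h] at this
  have hY : ∀ i, Y i = G * E i * Z := fun i => by
    rw [Matrix.mul_assoc, ← hFZ, ← Matrix.mul_assoc, hGF, Matrix.one_mul]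
  have pd1 : ∀ Φ1 : Matrix (Fin m1) (Fin m1) ℝ, Φ1.PosDef → (Gᵀ * Φ1 * G).PosDef := by
    intro Φ1 h
    have := h.conjTranspose_mul_mul_same (B := G)
      (mulVec_injective_of_isUnit ((isUnit_iff_isUnit_det G).2 (isUnit_iff_ne_zero.2 hGdet)))
    rwa [conjTranspose_eq_transpose_of_trivial] at this
  have pd2 : ∀ Φ2 : Matrix (Fin m2) (Fin m2) ℝ, Φ2.PosDef → (Z * Φ2 * Zᵀ).PosDef := by
    intro Φ2 h
    have := h.mul_mul_conjTranspose_same (B := Z)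
      (vecMul_injective_of_isUnit ((isUnit_iff_isUnit_det Z).2 hZu))
    rwa [conjTranspose_eq_transpose_of_trivial] at this
  have hell : ∀ (Φ1 : Matrix (Fin m1) (Fin m1) ℝ) (Φ2 : Matrix (Fin m2) (Fin m2) ℝ),
      Φ1.PosDef → Φ2.PosDef → ell Y Φ1 Φ2 = ell E (Gᵀ * Φ1 * G) (Z * Φ2 * Zᵀ)
        - ((n : ℝ) * m2 * Real.log (G.det ^ 2) + (n : ℝ) * m1 * Real.log (Z.det ^ 2)) := by
    intro Φ1 Φ2 p1 p2
    have d1 : Real.log (Gᵀ * Φ1 * G).det = Real.log (G.det ^ 2) + Real.log Φ1.det := by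
      rw [det_mul, det_mul, det_transpose, ← Real.log_mul (by positivity) p1.det_pos.ne']
      congr 1
      ring
    have d2 : Real.log (Z * Φ2 * Zᵀ).det = Real.log (Z.det ^ 2) + Real.log Φ2.det := by
      rw [det_mul, det_mul, det_transpose, ← Real.log_mul (by positivity) p2.det_pos.ne']
      congr 1
      ring
    have ht : (Φ1 * ∑ i, Y i * Φ2 * (Y i)ᵀ).trace =
        (Gᵀ * Φ1 * G * ∑ i, E i * (Z * Φ2 * Zᵀ) * (E i)ᵀ).trace := by
      have : ∑ i, Y i * Φ2 * (Y i)ᵀ = G * (∑ i, E i * (Z * Φ2 * Zᵀ) * (E i)ᵀ) * Gᵀ := by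
        simp only [hY, Finset.sum_mul, Finset.mul_sum, transpose_mul, Matrix.mul_assoc]
      rw [this, ← Matrix.mul_assoc, trace_mul_comm]
      simp only [Matrix.mul_assoc]
    unfold ell
    rw [d1, d2, ht]
    ring
  have hmaxval : ∀ (Φ1 : Matrix (Fin m1) (Fin m1) ℝ) (Φ2 : Matrix (Fin m2) (Fin m2) ℝ),
      Φ1.PosDef → Φ2.PosDef → ell Y Φ1 Φ2 ≤ ell E 1 1
        - ((n : ℝ) * m2 * Real.log (G.det ^ 2) + (n : ℝ) * m1 * Real.log (Z.det ^ 2)) := by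
    intro Φ1 Φ2 p1 p2
    rw [hell _ _ p1 p2]
    have := (balanced E h1 h2 (pd1 _ p1) (pd2 _ p2)).1
    linarith
  have q1 : (Fᵀ * F).PosDef := by
    have := PosDef.conjTranspose_mul_self F
      (mulVec_injective_of_isUnit ((isUnit_iff_isUnit_det F).2 hFu))
    rwa [conjTranspose_eq_transpose_of_trivial] at this
  have hZiu : IsUnit Z⁻¹ := by
    rw [isUnit_nonsing_inv_iff]
    exact (isUnit_iff_isUnit_det Z).2 hZu
  have q2 : (Z⁻¹ * (Z⁻¹)ᵀ).PosDef := by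
    have := PosDef.mul_conjTranspose_self Z⁻¹ (vecMul_injective_of_isUnit hZiu)
    rwa [conjTranspose_eq_transpose_of_trivial] at this
  have hval : ell Y (Fᵀ * F) (Z⁻¹ * (Z⁻¹)ᵀ) = ell E 1 1
        - ((n : ℝ) * m2 * Real.log (G.det ^ 2) + (n : ℝ) * m1 * Real.log (Z.det ^ 2)) := by
    rw [hell _ _ q1 q2]
    have e1 : Gᵀ * (Fᵀ * F) * G = 1 := by
      calc Gᵀ * (Fᵀ * F) * G = (F * G)ᵀ * (F * G) := by
            simp only [transpose_mul, Matrix.mul_assoc]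
        _ = 1 := by rw [hFG]; simp
    have e2 : Z * (Z⁻¹ * (Z⁻¹)ᵀ) * Zᵀ = 1 := by
      calc Z * (Z⁻¹ * (Z⁻¹)ᵀ) * Zᵀ = (Z * Z⁻¹) * (Z * Z⁻¹)ᵀ := by
            simp only [transpose_mul, Matrix.mul_assoc]
        _ = 1 := by rw [mul_nonsing_inv Z hZu]; simp
    rw [e1, e2]
  refine ⟨⟨Fᵀ * F, Z⁻¹ * (Z⁻¹)ᵀ, q1, q2, fun Φ1 Φ2 p1 p2 => ?_⟩, ?_⟩
  · rw [hval]
    exact hmaxval _ _ p1 p2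
  · have main : ∀ (Φ1 : Matrix (Fin m1) (Fin m1) ℝ) (Φ2 : Matrix (Fin m2) (Fin m2) ℝ),
        Φ1.PosDef → Φ2.PosDef →
        (∀ (Θ1 : Matrix (Fin m1) (Fin m1) ℝ) (Θ2 : Matrix (Fin m2) (Fin m2) ℝ),
          Θ1.PosDef → Θ2.PosDef → ell Y Θ1 Θ2 ≤ ell Y Φ1 Φ2) →
        (Z ⊗ₖ Gᵀ) * (Φ2 ⊗ₖ Φ1) * (Zᵀ ⊗ₖ G) = 1 := by
      intro Φ1 Φ2 p1 p2 hmax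
      rw [← mul_kronecker_mul, ← mul_kronecker_mul]
      apply hrig _ _ (pd1 _ p1) (pd2 _ p2)
      apply (balanced E h1 h2 (pd1 _ p1) (pd2 _ p2)).2
      have a1 := hmax _ _ q1 q2
      have a2 := hmaxval _ _ p1 p2
      rw [hval] at a1
      have a3 := hell _ _ p1 p2
      linarith
    intro Ψ1 Φ1 Ψ2 Φ2 p1 p2 p3 p4 m1 m2
    have b1 := main _ _ p1 p2 m1
    have b2 := main _ _ p3 p4 m2
    have u1 : IsUnit (Z ⊗ₖ Gᵀ) := by
      rw [isUnit_iff_isUnit_det, isUnit_iff_ne_zero, det_kronecker, det_transpose]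
      positivity
    have u2 : IsUnit (Zᵀ ⊗ₖ G) := by
      rw [isUnit_iff_isUnit_det, isUnit_iff_ne_zero, det_kronecker, det_transpose]
      positivity
    exact u1.mul_left_cancel (u2.mul_right_cancel (b1.trans b2.symm))

noncomputable def wp (m : ℕ) (j : Fin m) : ℝ := √(2 * ((m : ℝ) - j))
noncomputable def wq (m : ℕ) (j : Fin m) : ℝ := √(2 * ((j : ℝ) + 1))

lemma wp_sq (m : ℕ) (j : Fin m) : wp m j * wp m j = 2 * ((m : ℝ) - j) := by
  apply Real.mul_self_sqrt
  have : (j : ℝ) < m := by exact_mod_cast j.2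
  linarith
lemma wq_sq (m : ℕ) (j : Fin m) : wq m j * wq m j = 2 * ((j : ℝ) + 1) := by
  apply Real.mul_self_sqrt
  positivity
lemma wp_ne (m : ℕ) (j : Fin m) : wp m j ≠ 0 := by
  apply (Real.sqrt_pos.2 _).ne'
  have : (j : ℝ) < m := by exact_mod_cast j.2
  linarith
lemma wq_ne (m : ℕ) (j : Fin m) : wq m j ≠ 0 := by
  apply (Real.sqrt_pos.2 _).ne'
  positivity

/-- The balanced representative of the generic orbit. -/
noncomputable def EE (m : ℕ) : Fin 2 → Matrix (Fin (m + 1)) (Fin m) ℝ :=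
  ![Matrix.of fun k j => if k = j.castSucc then wp m j else 0,
    Matrix.of fun k j => if k = j.succ then wq m j else 0]

lemma EE0 (m : ℕ) (k j) : EE m 0 k j = if k = j.castSucc then wp m j else 0 := rfl
lemma EE1 (m : ℕ) (k j) : EE m 1 k j = if k = j.succ then wq m j else 0 := rfl

lemma mul_EE0 (m : ℕ) (F : Matrix (Fin (m+1)) (Fin (m+1)) ℝ) (k j) :
    (F * EE m 0) k j = F k j.castSucc * wp m j := by
  simp [Matrix.mul_apply, EE0]
lemma mul_EE1 (m : ℕ) (F : Matrix (Fin (m+1)) (Fin (m+1)) ℝ) (k j) :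
    (F * EE m 1) k j = F k j.succ * wq m j := by
  simp [Matrix.mul_apply, EE1]
lemma EE0_mul_castSucc (m : ℕ) {l : ℕ} (Z : Matrix (Fin m) (Fin l) ℝ) (k : Fin m) (j) :
    (EE m 0 * Z) k.castSucc j = wp m k * Z k j := by
  simp [Matrix.mul_apply, EE0]
lemma EE0_mul_last (m : ℕ) {l : ℕ} (Z : Matrix (Fin m) (Fin l) ℝ) (j) :
    (EE m 0 * Z) (Fin.last m) j = 0 := by
  simp [Matrix.mul_apply, EE0, (Fin.castSucc_lt_last _).ne']
lemma EE1_mul_succ (m : ℕ) {l : ℕ} (Z : Matrix (Fin m) (Fin l) ℝ) (k : Fin m) (j) :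
    (EE m 1 * Z) k.succ j = wq m k * Z k j := by
  simp [Matrix.mul_apply, EE1]
lemma EE1_mul_zero (m : ℕ) {l : ℕ} (Z : Matrix (Fin m) (Fin l) ℝ) (j) :
    (EE m 1 * Z) 0 j = 0 := by
  simp [Matrix.mul_apply, EE1, (Fin.succ_ne_zero _).symm]

lemma EE_bal1 (m : ℕ) : ∑ i, EE m i * (EE m i)ᵀ =
    (((2 : ℕ) : ℝ) * m) • (1 : Matrix (Fin (m+1)) (Fin (m+1)) ℝ) := by
  rw [Fin.sum_univ_two]
  have A : EE m 0 * (EE m 0)ᵀ = diagonal fun k : Fin (m + 1) => 2 * ((m : ℝ) - (k : ℕ)) := by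
    ext k l
    refine Fin.lastCases ?_ (fun k => ?_) k
    · rw [EE0_mul_last]
      by_cases h : Fin.last m = l <;> simp [diagonal_apply, h]
      subst h
      simp
    · rw [EE0_mul_castSucc, transpose_apply, EE0, diagonal_apply]
      by_cases h : k.castSucc = l
      · subst h
        simp [wp_sq]
      · simp [h, Ne.symm h]
  have B : EE m 1 * (EE m 1)ᵀ = diagonal fun k : Fin (m + 1) => 2 * ((k : ℕ) : ℝ) := by
    ext k l
    refine Fin.cases ?_ (fun k => ?_) k
    · rw [EE1_mul_zero]
      by_cases h : 0 = l <;> simp [h]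
    · rw [EE1_mul_succ, transpose_apply, EE1, diagonal_apply]
      by_cases h : k.succ = l
      · subst h
        simp [wq_sq]
      · simp [h, Ne.symm h]
  rw [A, B, diagonal_add, smul_one_eq_diagonal]
  congr 1
  funext k
  push_cast
  ring

lemma EE_bal2 (m : ℕ) : ∑ i, (EE m i)ᵀ * EE m i =
    (((2 : ℕ) : ℝ) * ((m + 1 : ℕ) : ℝ)) • (1 : Matrix (Fin m) (Fin m) ℝ) := by
  rw [Fin.sum_univ_two]
  ext k l
  simp only [Matrix.add_apply, Matrix.mul_apply, transpose_apply, EE0, EE1, Matrix.smul_apply,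
    one_apply]
  by_cases h : k = l
  · subst h
    simp [wp_sq, wq_sq]
    ring
  · simp [h, Ne.symm h]

lemma rigid (m : ℕ) (F : Matrix (Fin (m+1)) (Fin (m+1)) ℝ)
    (e0 : ∀ j, (F * EE m 1) 0 j = 0) (e1 : ∀ j, (F * EE m 0) (Fin.last m) j = 0)
    (e2 : ∀ k j : Fin m, wq m k * (F * EE m 0) k.castSucc j = wp m k * (F * EE m 1) k.succ j) :
    ∃ c : ℝ, F = c • 1 := by
  simp only [mul_EE0, mul_EE1] at e0 e1 e2
  have z0 : ∀ j : Fin m, F 0 j.succ = 0 := fun j => (mul_eq_zero.1 (e0 j)).resolve_right (wq_ne m j)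
  have z1 : ∀ j : Fin m, F (Fin.last m) j.castSucc = 0 := fun j =>
    (mul_eq_zero.1 (e1 j)).resolve_right (wp_ne m j)
  have up : ∀ k j, k < j → F k j = 0 := by
    intro k
    induction k using Fin.induction with
    | zero =>
      intro j hj
      obtain ⟨j, rfl⟩ := Fin.exists_succ_eq.2 hj.ne'
      exact z0 j
    | succ k ih =>
      intro j hj
      obtain ⟨j, rfl⟩ := Fin.exists_succ_eq.2 (ne_of_gt ((Fin.succ_pos k).trans hj))
      have := e2 k j
      rw [ih j.castSucc (by simpa using hj)] at this
      simpa [wp_ne, wq_ne] using this.symm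
  have down : ∀ k j, j < k → F k j = 0 := by
    intro k
    induction k using Fin.reverseInduction with
    | last =>
      intro j hj
      obtain ⟨j, rfl⟩ := Fin.exists_castSucc_eq.2 hj.ne
      exact z1 j
    | cast k ih =>
      intro j hj
      obtain ⟨j, rfl⟩ := Fin.exists_castSucc_eq.2 (hj.trans (Fin.castSucc_lt_last k)).ne
      have := e2 k j
      rw [ih j.succ (by simpa using hj)] at this
      simpa [wp_ne, wq_ne] using this
  have dg : ∀ k, F k k = F 0 0 := by
    intro k
    induction k using Fin.induction with
    | zero => rfl
    | succ k ih =>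
      have := e2 k k
      rw [ih] at this
      have h : (wp m k * wq m k) * F k.succ k.succ = (wp m k * wq m k) * F 0 0 := by linarith
      exact mul_left_cancel₀ (mul_ne_zero (wp_ne m k) (wq_ne m k)) h
  refine ⟨F 0 0, ?_⟩
  ext k j
  rcases lt_trichotomy k j with h | h | h
  · simp [up k j h, h.ne]
  · subst h
    simp [dg k]
  · simp [down k j h, h.ne']

lemma EE_rig (m : ℕ) (Φ1 : Matrix (Fin (m+1)) (Fin (m+1)) ℝ) (Φ2 : Matrix (Fin m) (Fin m) ℝ)
    (p2 : Φ2.PosDef) (h : ∀ i, Φ1 * EE m i * Φ2 = EE m i) : Φ2 ⊗ₖ Φ1 = 1 := by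
  have h' : ∀ i, Φ1 * EE m i = EE m i * Φ2⁻¹ := fun i => by
    conv_rhs => rw [← h i]
    rw [Matrix.mul_assoc, mul_nonsing_inv _ (isUnit_iff_ne_zero.2 p2.det_pos.ne'), Matrix.mul_one]
  obtain ⟨c, hc⟩ := rigid m Φ1 (fun j => by rw [h', EE1_mul_zero])
    (fun j => by rw [h', EE0_mul_last])
    (fun k j => by
      rw [h', h', EE0_mul_castSucc, EE1_mul_succ]
      ring)
  have hc2 : c • Φ2 = 1 := by
    ext k j
    have := congrFun (congrFun (h 0) k.castSucc) j
    rw [hc, Matrix.smul_mul, Matrix.one_mul, Matrix.smul_mul, Matrix.smul_apply, EE0_mul_castSucc,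
      EE0] at this
    by_cases hkj : k = j
    · subst hkj
      simp only [if_true] at this
      simp only [Matrix.smul_apply, smul_eq_mul, one_apply_eq] at *
      apply mul_left_cancel₀ (wp_ne m k)
      linarith
    · simp [hkj, wp_ne] at this
      simp [hkj, this]
  rw [hc, kronecker_smul, ← smul_kronecker, hc2, one_kronecker_one]

abbrev EqIdx (m : ℕ) := Unit ⊕ (Fin m ⊕ (Fin m ⊕ (Fin m × Fin m)))
abbrev UnkIdx (m : ℕ) := Fin (m + 1) × Fin (m + 1)

noncomputable def idxEquiv (m : ℕ) : UnkIdx m ≃ EqIdx m :=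
  Fintype.equivOfCardEq (by simp; ring)

/-- The left-hand sides of the square linear system. -/
noncomputable def sysL (m : ℕ) (Y : Fin 2 → Matrix (Fin (m + 1)) (Fin m) ℝ) :
    Matrix (Fin (m+1)) (Fin (m+1)) ℝ → EqIdx m → ℝ := fun F =>
  Sum.elim (fun _ => F.trace) (Sum.elim (fun j => (F * Y 1) 0 j)
    (Sum.elim (fun j => (F * Y 0) (Fin.last m) j)
      (fun kj => wq m kj.1 * (F * Y 0) kj.1.castSucc kj.2 -
        wp m kj.1 * (F * Y 1) kj.1.succ kj.2)))

lemma sysL_add (m : ℕ) (Y : Fin 2 → Matrix (Fin (m + 1)) (Fin m) ℝ)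
    (A B : Matrix (Fin (m+1)) (Fin (m+1)) ℝ) (t : EqIdx m) :
    sysL m Y (A + B) t = sysL m Y A t + sysL m Y B t := by
  rcases t with _ | _ | _ | _ <;> simp [sysL, Matrix.add_mul]
  ring

lemma sysL_smul (m : ℕ) (Y : Fin 2 → Matrix (Fin (m + 1)) (Fin m) ℝ)
    (c : ℝ) (A : Matrix (Fin (m+1)) (Fin (m+1)) ℝ) (t : EqIdx m) :
    sysL m Y (c • A) t = c * sysL m Y A t := by
  rcases t with _ | _ | _ | _ <;> simp [sysL]
  ring

noncomputable def sysLin (m : ℕ) (Y : Fin 2 → Matrix (Fin (m + 1)) (Fin m) ℝ) :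
    (UnkIdx m → ℝ) →ₗ[ℝ] (UnkIdx m → ℝ) where
  toFun v a := sysL m Y (Matrix.of fun k r => v (k, r)) (idxEquiv m a)
  map_add' v w := by
    have : (Matrix.of fun k r => (v + w) (k, r) : Matrix (Fin (m+1)) (Fin (m+1)) ℝ) =
      Matrix.of (fun k r => v (k, r)) + Matrix.of (fun k r => w (k, r)) := by ext; simp
    funext a
    rw [this, sysL_add]
    rfl
  map_smul' c v := by
    have : (Matrix.of fun k r => (c • v) (k, r) : Matrix (Fin (m+1)) (Fin (m+1)) ℝ) =
      c • Matrix.of (fun k r => v (k, r)) := by ext; simp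
    funext a
    rw [this, sysL_smul]
    rfl

noncomputable def sysM (m : ℕ) (Y : Fin 2 → Matrix (Fin (m + 1)) (Fin m) ℝ) :
    Matrix (UnkIdx m) (UnkIdx m) ℝ := LinearMap.toMatrix' (sysLin m Y)

noncomputable def rhsB (m : ℕ) : UnkIdx m → ℝ := fun a =>
  (Sum.elim (fun _ => 1) (fun _ => 0) : EqIdx m → ℝ) (idxEquiv m a)

noncomputable def solF (m : ℕ) (Y : Fin 2 → Matrix (Fin (m + 1)) (Fin m) ℝ) :
    Matrix (Fin (m+1)) (Fin (m+1)) ℝ := Matrix.of fun k r => cramer (sysM m Y) (rhsB m) (k, r)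

lemma sysL_solF (m : ℕ) (Y : Fin 2 → Matrix (Fin (m + 1)) (Fin m) ℝ) (t : EqIdx m) :
    sysL m Y (solF m Y) t = (sysM m Y).det * (Sum.elim (fun _ => 1) (fun _ => 0) : EqIdx m → ℝ) t := by
  have h := mulVec_cramer (sysM m Y) (rhsB m)
  have h2 : sysM m Y *ᵥ cramer (sysM m Y) (rhsB m) =
      sysLin m Y (cramer (sysM m Y) (rhsB m)) := by
    rw [sysM, LinearMap.toMatrix'_mulVec]
  rw [h2] at h
  have h3 := congrFun h ((idxEquiv m).symm t)
  simpa [sysLin, rhsB, solF] using h3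

lemma solF_eqs (m : ℕ) (Y : Fin 2 → Matrix (Fin (m + 1)) (Fin m) ℝ) :
    (solF m Y).trace = (sysM m Y).det ∧ (∀ j, (solF m Y * Y 1) 0 j = 0) ∧
    (∀ j, (solF m Y * Y 0) (Fin.last m) j = 0) ∧
    (∀ k j : Fin m, wq m k * (solF m Y * Y 0) k.castSucc j =
      wp m k * (solF m Y * Y 1) k.succ j) := by
  refine ⟨?_, fun j => ?_, fun j => ?_, fun k j => ?_⟩
  · simpa [sysL] using sysL_solF m Y (Sum.inl ())
  · simpa [sysL] using sysL_solF m Y (Sum.inr (Sum.inl j))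
  · simpa [sysL] using sysL_solF m Y (Sum.inr (Sum.inr (Sum.inl j)))
  · have := sysL_solF m Y (Sum.inr (Sum.inr (Sum.inr (k, j))))
    simp [sysL] at this
    linarith

lemma sysM_EE_det (m : ℕ) : (sysM m (EE m)).det ≠ 0 := by
  intro h
  obtain ⟨v, hv, h0⟩ := exists_mulVec_eq_zero_iff.2 h
  apply hv
  rw [sysM, LinearMap.toMatrix'_mulVec] at h0
  have ht : ∀ t, sysL m (EE m) (Matrix.of fun k r => v (k, r)) t = 0 := fun t => by
    have := congrFun h0 ((idxEquiv m).symm t)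
    simpa [sysLin] using this
  obtain ⟨c, hc⟩ := rigid m (Matrix.of fun k r => v (k, r))
    (fun j => by simpa [sysL] using ht (Sum.inr (Sum.inl j)))
    (fun j => by simpa [sysL] using ht (Sum.inr (Sum.inr (Sum.inl j))))
    (fun k j => by
      have := ht (Sum.inr (Sum.inr (Sum.inr (k, j))))
      simp only [sysL, Sum.elim_inr] at this
      linarith)
  have h1 := ht (Sum.inl ())
  simp only [sysL, Sum.elim_inl] at h1
  rw [hc] at h1
  have hc0 : c = 0 := by
    simp at h1
    rcases h1 with h1 | h1
    · exact h1
    · exfalso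
      have : (0 : ℝ) ≤ m := by positivity
      linarith
  funext kr
  have := congrFun (congrFun hc kr.1) kr.2
  simpa [hc0] using this

/-- The upper block of `F * Y 0`. -/
noncomputable def topW (m : ℕ) (Y : Fin 2 → Matrix (Fin (m + 1)) (Fin m) ℝ) :
    Matrix (Fin m) (Fin m) ℝ := Matrix.of fun k j => (solF m Y * Y 0) k.castSucc j

lemma solF_EE (m : ℕ) : (solF m (EE m)).det ≠ 0 ∧ (topW m (EE m)).det ≠ 0 := by
  obtain ⟨h0, h1, h2, h3⟩ := solF_eqs m (EE m)
  obtain ⟨c, hc⟩ := rigid m _ h1 h2 h3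
  have hc0 : c ≠ 0 := by
    rintro rfl
    apply sysM_EE_det m
    rw [← h0, hc]
    simp
  constructor
  · rw [hc]
    simp [hc0]
  · have : topW m (EE m) = diagonal fun j => c * wp m j := by
      ext k j
      simp only [topW, of_apply]
      rw [hc, Matrix.smul_mul, Matrix.one_mul, Matrix.smul_apply, EE0, diagonal_apply]
      by_cases h : k = j
      · subst h
        simp
      · simp [h]
    rw [this, det_diagonal]
    exact Finset.prod_ne_zero_iff.2 fun j _ => mul_ne_zero hc0 (wp_ne m j)

abbrev YIdx (m : ℕ) := Fin 2 × Fin (m + 1) × Fin m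

noncomputable def Yof (m : ℕ) (y : YIdx m → ℝ) : Fin 2 → Matrix (Fin (m + 1)) (Fin m) ℝ :=
  fun i : Fin 2 => Matrix.of fun r c => y (i, r, c)

lemma poly_mulY {m : ℕ} {F : (YIdx m → ℝ) → Matrix (Fin (m+1)) (Fin (m+1)) ℝ}
    (hF : ∀ k r, IsPolyFn (fun y => F y k r)) (i k j) :
    IsPolyFn (fun y => (F y * Yof m y i) k j) := by
  simp only [Matrix.mul_apply]
  exact IsPolyFn.sum _ fun r => (hF k r).mul (IsPolyFn.coord (i, r, j))

lemma poly_sysM (m : ℕ) (a b : UnkIdx m) : IsPolyFn (fun y => sysM m (Yof m y) a b) := by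
  have key : ∀ (F : Matrix (Fin (m+1)) (Fin (m+1)) ℝ) (t : EqIdx m),
      IsPolyFn (fun y => sysL m (Yof m y) F t) := by
    intro F t
    have hp := fun i k j => poly_mulY (m := m) (F := fun _ => F)
      (fun k r => IsPolyFn.const (F k r)) i k j
    rcases t with _ | j | j | ⟨k, j⟩
    · exact IsPolyFn.const _
    · exact hp 1 0 j
    · exact hp 0 (Fin.last m) j
    · exact ((IsPolyFn.const _).mul (hp 0 k.castSucc j)).sub
        ((IsPolyFn.const _).mul (hp 1 k.succ j))
  have : ∀ y, sysM m (Yof m y) a b = sysL m (Yof m y)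
      (Matrix.of fun k r => (Pi.single b 1 : UnkIdx m → ℝ) (k, r)) (idxEquiv m a) := by
    intro y
    rw [sysM, LinearMap.toMatrix'_apply]
    simp only [sysLin, LinearMap.coe_mk, AddHom.coe_mk, Pi.single_apply]
  simp only [this]
  exact key _ _

lemma poly_solF (m : ℕ) (k r) : IsPolyFn (fun y => solF m (Yof m y) k r) :=
  IsPolyFn.cramer (poly_sysM m) _ _

lemma generic (m : ℕ) : ∀ᵐ y : YIdx m → ℝ ∂(Measure.pi fun _ => gaussianReal 0 1),
    (solF m (Yof m y)).det ≠ 0 ∧ (topW m (Yof m y)).det ≠ 0 := by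
  have hE : Yof m (fun t => EE m t.1 t.2.1 t.2.2) = EE m := rfl
  have h1 := (IsPolyFn.det (poly_solF m)).ae_ne (fun t => EE m t.1 t.2.1 t.2.2)
    (by rw [hE]; exact (solF_EE m).1)
  have h2 := (IsPolyFn.det (M := fun y => topW m (Yof m y))
    (fun k j => poly_mulY (poly_solF m) 0 k.castSucc j)).ae_ne (fun t => EE m t.1 t.2.1 t.2.2)
    (by rw [hE]; exact (solF_EE m).2)
  filter_upwards [h1, h2] with y a b
  exact ⟨a, b⟩

lemma solF_intertwine (m : ℕ) (Y : Fin 2 → Matrix (Fin (m + 1)) (Fin m) ℝ) (i : Fin 2) :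
    solF m Y * Y i = EE m i * (diagonal (fun j => (wp m j)⁻¹) * topW m Y) := by
  obtain ⟨-, h1, h2, h3⟩ := solF_eqs m Y
  ext k j
  fin_cases i
  · show (solF m Y * Y 0) k j = (EE m 0 * (diagonal (fun j => (wp m j)⁻¹) * topW m Y)) k j
    refine Fin.lastCases ?_ (fun k => ?_) k
    · rw [h2, EE0_mul_last]
    · rw [EE0_mul_castSucc, diagonal_mul, mul_inv_cancel_left₀ (wp_ne m k)]
      rfl
  · show (solF m Y * Y 1) k j = (EE m 1 * (diagonal (fun j => (wp m j)⁻¹) * topW m Y)) k j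
    refine Fin.cases ?_ (fun k => ?_) k
    · rw [h1, EE1_mul_zero]
    · rw [EE1_mul_succ, diagonal_mul]
      show _ = wq m k * ((wp m k)⁻¹ * (solF m Y * Y 0) k.castSucc j)
      rw [mul_left_comm, h3, inv_mul_cancel_left₀ (wp_ne m k)]

/-- For sample size `n = 2`, `m1 = m + 1`, `m2 = m` with `m ≥ 2`, for almost every pair
`(Y_1, Y_2)` of `(m+1) × m` matrices with i.i.d. standard normal entries, the
log-likelihood attains its maximum on `PD(m+1) × PD(m)` and any two maximizers have
equal Kronecker products: the Kronecker MLE exists uniquely almost surely. -/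
theorem stmt19 {m : ℕ} (hm : 2 ≤ m) :
    ∀ᵐ y : Fin 2 × Fin (m + 1) × Fin m → ℝ
        ∂(Measure.pi fun _ => gaussianReal 0 1),
      (∃ (Ψ1 : Matrix (Fin (m + 1)) (Fin (m + 1)) ℝ) (Ψ2 : Matrix (Fin m) (Fin m) ℝ),
        Ψ1.PosDef ∧ Ψ2.PosDef ∧
        ∀ (Φ1 : Matrix (Fin (m + 1)) (Fin (m + 1)) ℝ) (Φ2 : Matrix (Fin m) (Fin m) ℝ),
          Φ1.PosDef → Φ2.PosDef →
          ell (fun i : Fin 2 => Matrix.of fun r c => y (i, r, c)) Φ1 Φ2 ≤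
            ell (fun i : Fin 2 => Matrix.of fun r c => y (i, r, c)) Ψ1 Ψ2) ∧
      (∀ (Ψ1 Φ1 : Matrix (Fin (m + 1)) (Fin (m + 1)) ℝ)
          (Ψ2 Φ2 : Matrix (Fin m) (Fin m) ℝ),
        Ψ1.PosDef → Ψ2.PosDef → Φ1.PosDef → Φ2.PosDef →
        (∀ (Θ1 : Matrix (Fin (m + 1)) (Fin (m + 1)) ℝ) (Θ2 : Matrix (Fin m) (Fin m) ℝ),
          Θ1.PosDef → Θ2.PosDef →
          ell (fun i : Fin 2 => Matrix.of fun r c => y (i, r, c)) Θ1 Θ2 ≤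
            ell (fun i : Fin 2 => Matrix.of fun r c => y (i, r, c)) Ψ1 Ψ2) →
        (∀ (Θ1 : Matrix (Fin (m + 1)) (Fin (m + 1)) ℝ) (Θ2 : Matrix (Fin m) (Fin m) ℝ),
          Θ1.PosDef → Θ2.PosDef →
          ell (fun i : Fin 2 => Matrix.of fun r c => y (i, r, c)) Θ1 Θ2 ≤
            ell (fun i : Fin 2 => Matrix.of fun r c => y (i, r, c)) Φ1 Φ2) →
        Ψ2 ⊗ₖ Ψ1 = Φ2 ⊗ₖ Φ1) := by
  filter_upwards [generic m] with y hy
  refine transfer _ (EE m) (EE_bal1 m) (EE_bal2 m)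
    (fun Φ1 Φ2 _ p2 h => EE_rig m Φ1 Φ2 p2 h) (solF m (Yof m y))
    (diagonal (fun j => (wp m j)⁻¹) * topW m (Yof m y)) hy.1 ?_
    (fun i => solF_intertwine m (Yof m y) i)
  rw [det_mul, det_diagonal]
  exact mul_ne_zero (Finset.prod_ne_zero_iff.2 fun j _ => inv_ne_zero (wp_ne m j)) hy.2
end
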